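/- Let G be a topological group and let (V_n)_{n∈ℕ} be a decreasing sequence of open subgroups of G which forms a neighbourhood basis of the identity (every neighbourhood of 1 contains some V_n). Assume that for every n ∈ ℕ, the index of V_{n+1} in V_n is infinite. Then every compact subset of G has empty interior. -/

import Mathlib

/-- Proposition 5.13(2), abstract form: in a topological group with a decreasing
neighbourhood basis of `1` consisting of open subgroups `Vₙ` with `Vₙ₊₁` of infinite
index in `Vₙ`, every compact subset has empty interior. -/
theorem stmt_9 {G : Type*} [Group G] [TopologicalSpace G] [IsTopologicalGroup G]
    (V : ℕ → Subgroup G)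
    (hop : ∀ n, IsOpen (V n : Set G))
    (hdec : ∀ n, V (n + 1) ≤ V n)
    (hbasis : ∀ U ∈ nhds (1 : G), ∃ n, (V n : Set G) ⊆ U)
    (hinf : ∀ n, Infinite ((V n) ⧸ (V (n + 1)).subgroupOf (V n))) :
    ∀ C : Set G, IsCompact C → interior C = ∅ := by
  intro C hC
  rw [Set.eq_empty_iff_forall_notMem]
  intro x hx
  have hK : IsCompact ((fun y => x⁻¹ * y) '' C) := hC.image (continuous_const_mul x⁻¹)
  have hU : (fun y => x * y) ⁻¹' C ∈ nhds (1 : G) := by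
    apply (continuous_const_mul x).continuousAt.preimage_mem_nhds
    rw [mul_one]
    exact mem_interior_iff_mem_nhds.mp hx
  obtain ⟨n, hn⟩ := hbasis _ hU
  have hVc : IsCompact (V n : Set G) :=
    hK.of_isClosed_subset ((V n).isClosed_of_isOpen (hop n))
      (fun y hy => ⟨x * y, hn hy, by simp⟩)
  haveI : CompactSpace (V n) := isCompact_iff_compactSpace.mp hVc
  have hopen : IsOpen (((V (n + 1)).subgroupOf (V n) : Subgroup (V n)) : Set (V n)) :=
    (hop (n + 1)).preimage continuous_subtype_val
  haveI := Subgroup.quotient_finite_of_isOpen _ hopen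
  exact (hinf n).not_finite this
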